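/- Let G be a finite simple graph, l ≥ 0 an integer, and suppose G has the property that any two independent sets of G of size exactly l+1 are TAR_l-reachable from each other. Let I_ini be an independent set of G with |I_ini| ≥ l, and let I_max be a maximum independent set of G. Then the maximum size of an independent set I with I_ini ↝_l I equals |I_ini| if I_ini is a maximal independent set of G with |I_ini| = l, and equals |I_max| otherwise. -/

import Mathlib

def IsIndepSet {V : Type*} (G : SimpleGraph V) (I : Finset V) : Prop :=
  ∀ u ∈ I, ∀ v ∈ I, ¬ G.Adj u v

def TarStep {V : Type*} [DecidableEq V] (G : SimpleGraph V) (l : ℕ) (A B : Finset V) : Prop :=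
  IsIndepSet G A ∧ IsIndepSet G B ∧ l ≤ A.card ∧ l ≤ B.card ∧ (symmDiff A B).card = 1

def TarReach {V : Type*} [DecidableEq V] (G : SimpleGraph V) (l : ℕ) :
    Finset V → Finset V → Prop :=
  Relation.ReflTransGen (TarStep G l)

section

variable {V : Type*} {G : SimpleGraph V}

theorem IsIndepSet.mono {A B : Finset V} (hB : IsIndepSet G B) (hAB : A ⊆ B) :
    IsIndepSet G A :=
  fun u hu v hv => hB u (hAB hu) v (hAB hv)

variable [DecidableEq V] {l : ℕ}

theorem TarStep.symm {A B : Finset V} (h : TarStep G l A B) : TarStep G l B A := by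
  obtain ⟨hA, hB, hlA, hlB, hAB⟩ := h
  exact ⟨hB, hA, hlB, hlA, by rwa [symmDiff_comm]⟩

theorem TarReach.symm {A B : Finset V} (h : TarReach G l A B) : TarReach G l B A := by
  induction h with
  | refl => exact .refl
  | tail _ hstep ih => exact .head hstep.symm ih

theorem TarReach.isIndepSet {A B : Finset V} (h : TarReach G l A B) (hA : IsIndepSet G A) :
    IsIndepSet G B := by
  cases h with
  | refl => exact hA
  | tail _ h => exact h.2.1

theorem tarStep_insert {A : Finset V} {a : V} (ha : a ∉ A) (hl : l ≤ A.card)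
    (h : IsIndepSet G (insert a A)) : TarStep G l A (insert a A) := by
  refine ⟨h.mono (Finset.subset_insert a A), h, hl,
    hl.trans (Finset.card_le_card (Finset.subset_insert a A)), ?_⟩
  have : symmDiff A (insert a A) = {a} := by
    ext x
    simp only [Finset.mem_symmDiff, Finset.mem_insert, Finset.mem_singleton]
    grind
  simp [this]

theorem tarReach_union {A : Finset V} (hl : l ≤ A.card) (S : Finset V)
    (h : IsIndepSet G (A ∪ S)) : TarReach G l A (A ∪ S) := by
  induction S using Finset.induction_on with
  | empty =>
    rw [Finset.union_empty]
    exact .refl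
  | insert a S _ ih =>
    rw [Finset.union_insert] at h ⊢
    have hr := ih (h.mono (Finset.subset_insert _ _))
    by_cases ha : a ∈ A ∪ S
    · rwa [Finset.insert_eq_of_mem ha]
    · exact hr.tail (tarStep_insert ha
        (hl.trans (Finset.card_le_card Finset.subset_union_left)) h)

theorem tarReach_of_subset {A B : Finset V} (hAB : A ⊆ B) (hB : IsIndepSet G B)
    (hl : l ≤ A.card) : TarReach G l A B := by
  have h := tarReach_union (G := G) hl B
  rw [Finset.union_eq_right.mpr hAB] at h
  exact h hB

theorem not_tarStep_of_maximal {A B : Finset V}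
    (hA : ∀ J : Finset V, A ⊂ J → ¬ IsIndepSet G J) (hcard : A.card = l) :
    ¬ TarStep G l A B := by
  rintro ⟨-, hB, -, hlB, hAB⟩
  have hsd : (A \ B).card + (B \ A).card = 1 := by
    rw [← hAB, symmDiff_def, Finset.sup_eq_union,
      Finset.card_union_of_disjoint disjoint_sdiff_sdiff]
  have hcomm := Finset.card_sdiff_add_card_inter A B
  have hcomm' := Finset.card_sdiff_add_card_inter B A
  rw [Finset.inter_comm] at hcomm'
  have hsub : A ⊆ B := by
    rw [← Finset.sdiff_eq_empty_iff_subset, ← Finset.card_eq_zero]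
    omega
  exact hA B (hsub.ssubset_of_ne (by rintro rfl; simp at hAB)) hB

theorem TarReach.eq_of_maximal {A B : Finset V} (h : TarReach G l A B)
    (hA : ∀ J : Finset V, A ⊂ J → ¬ IsIndepSet G J) (hcard : A.card = l) : B = A := by
  rcases Relation.ReflTransGen.cases_head h with rfl | ⟨C, hC, -⟩
  · rfl
  · exact absurd hC (not_tarStep_of_maximal hA hcard)

theorem exists_tarReach_card_succ {A : Finset V} (hA : IsIndepSet G A) (hl : l ≤ A.card)
    (h : ¬ ((∀ J : Finset V, A ⊂ J → ¬ IsIndepSet G J) ∧ A.card = l)) :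
    ∃ B, TarReach G l A B ∧ B.card = l + 1 := by
  rcases hl.lt_or_eq with hlt | heq
  · obtain ⟨B, hBA, hB⟩ := Finset.exists_subset_card_eq (Nat.succ_le_of_lt hlt)
    exact ⟨B, (tarReach_of_subset hBA hA (by omega)).symm, hB⟩
  · have hJ : ∃ J : Finset V, A ⊂ J ∧ IsIndepSet G J := by
      by_contra! hno
      exact h ⟨hno, heq.symm⟩
    obtain ⟨J, hAJ, hJ⟩ := hJ
    obtain ⟨a, ha, hsub⟩ := Finset.ssubset_iff.mp hAJ
    exact ⟨insert a A, .single (tarStep_insert ha hl (hJ.mono hsub)), by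
      rw [Finset.card_insert_of_notMem ha, heq]⟩

end

/-- if any two independent sets of size exactly `l+1` are TAR_l-reachable
from each other, then the maximum size of an independent set reachable from `I_ini`
under TAR_l equals `|I_ini|` if `I_ini` is maximal with `|I_ini| = l`, and equals the
maximum independent set size otherwise. -/
theorem tarReach_opt_value {V : Type*} [Fintype V] [DecidableEq V]
    (G : SimpleGraph V) (l : ℕ)
    (hconn : ∀ A B : Finset V, IsIndepSet G A → IsIndepSet G B →
      A.card = l + 1 → B.card = l + 1 → TarReach G l A B)
    (Iini : Finset V) (hini : IsIndepSet G Iini) (hl : l ≤ Iini.card)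
    (Imax : Finset V) (hmaxI : IsIndepSet G Imax)
    (hmax : ∀ J : Finset V, IsIndepSet G J → J.card ≤ Imax.card) :
    (((∀ J : Finset V, Iini ⊂ J → ¬ IsIndepSet G J) ∧ Iini.card = l) →
      ((∃ I : Finset V, TarReach G l Iini I ∧ I.card = Iini.card) ∧
        ∀ I : Finset V, TarReach G l Iini I → I.card ≤ Iini.card)) ∧
    (¬ ((∀ J : Finset V, Iini ⊂ J → ¬ IsIndepSet G J) ∧ Iini.card = l) →
      ((∃ I : Finset V, TarReach G l Iini I ∧ I.card = Imax.card) ∧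
        ∀ I : Finset V, TarReach G l Iini I → I.card ≤ Imax.card)) := by
  refine ⟨fun ⟨hm, hc⟩ => ⟨⟨Iini, .refl, rfl⟩, fun I hI => by rw [hI.eq_of_maximal hm hc]⟩,
    fun h => ⟨⟨Imax, ?_, rfl⟩, fun I hI => hmax I (hI.isIndepSet hini)⟩⟩
  obtain ⟨A, hA, hAcard⟩ := exists_tarReach_card_succ hini hl h
  have hAind := hA.isIndepSet hini
  obtain ⟨B, hBsub, hBcard⟩ := Finset.exists_subset_card_eq (hAcard ▸ hmax A hAind)
  exact (hA.trans (hconn A B hAind (hmaxI.mono hBsub) hAcard hBcard)).trans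
    (tarReach_of_subset hBsub hmaxI (by omega))
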